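/- Let (S, P) be a finite Markov chain with initial state ŝ, let ε > 0, and let B be a set of bottom strongly connected components of (S,P). Suppose that for each R ∈ B we are given l^{◇R} ∈ [0,1] with l^{◇R} ≤ reach(ŝ,R), and functions l^R, u^R : R → [0,1] with l^R(s) ≤ π_R(s) ≤ u^R(s) for all s ∈ R. Put L = Σ_{R∈B} l^{◇R} and assume the termination condition (1 − L) + Σ_{R∈B} l^{◇R} · max_{s∈R}(u^R(s) − l^R(s)) ≤ ε. Then for every R ∈ B and every s ∈ R, setting l(s) = l^{◇R} · l^R(s) and u(s) = (l^{◇R} + 1 − L) · u^R(s), we have l(s) ≤ π_ŝ(s) ≤ u(s) and u(s) − l(s) ≤ ε. -/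

import Mathlib

open Finset Filter Topology

/-- `P` is a row-stochastic transition matrix. -/
def IsStochastic {S : Type*} [Fintype S] (P : Matrix S S ℝ) : Prop :=
  (∀ s s', 0 ≤ P s s') ∧ ∀ s, ∑ s', P s s' = 1

/-- `R` is a bottom strongly connected component of the transition graph of `P`:
a nonempty, maximal strongly connected set of states with no transitions leaving it. -/
def IsBSCC {S : Type*} [Fintype S] (P : Matrix S S ℝ) (R : Finset S) : Prop :=
  R.Nonempty ∧
  (∀ a ∈ R, ∀ b ∈ R, Relation.ReflTransGen (fun x y => 0 < P x y) a b) ∧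
  (∀ C : Finset S, R ⊆ C →
    (∀ a ∈ C, ∀ b ∈ C, Relation.ReflTransGen (fun x y => 0 < P x y) a b) → C = R) ∧
  (∀ s ∈ R, ∀ s' ∉ R, P s s' = 0)

theorem IsStochastic.pow {S : Type*} [Fintype S] [DecidableEq S] {P : Matrix S S ℝ}
    (hP : IsStochastic P) (n : ℕ) : IsStochastic (P ^ n) := by
  induction n with
  | zero =>
    refine ⟨fun s t => ?_, fun s => ?_⟩
    · rw [pow_zero, Matrix.one_apply]; split_ifs <;> norm_num
    · simp [Matrix.one_apply]
  | succ n ih =>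
    refine ⟨fun s t => ?_, fun s => ?_⟩
    · rw [pow_succ, Matrix.mul_apply]
      exact Finset.sum_nonneg fun j _ => mul_nonneg (ih.1 s j) (hP.1 j t)
    · simp only [pow_succ, Matrix.mul_apply]
      rw [Finset.sum_comm]
      simp only [← Finset.mul_sum, hP.2, mul_one, ih.2]

theorem IsStochastic.le_one {S : Type*} [Fintype S] {P : Matrix S S ℝ}
    (hP : IsStochastic P) (s t : S) : P s t ≤ 1 := by
  rw [← hP.2 s]
  exact Finset.single_le_sum (f := fun t => P s t) (fun j _ => hP.1 s j) (Finset.mem_univ t)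

theorem sum_Icc_one_eq_sum_range {M : Type*} [AddCommMonoid M] (f : ℕ → M) (n : ℕ) :
    ∑ i ∈ Finset.Icc 1 n, f i = ∑ i ∈ Finset.range n, f (i + 1) := by
  induction n with
  | zero => simp
  | succ n ih => rw [Finset.sum_Icc_succ_top (by omega), Finset.sum_range_succ, ih]

/-- A Cesàro limit of the powers of a stochastic matrix is invariant. -/
theorem IsStochastic.sum_mul_eq_of_tendsto_cesaro {S : Type*} [Fintype S] [DecidableEq S]
    {P : Matrix S S ℝ} (hP : IsStochastic P) {a : S} {μ : S → ℝ}
    (hμ : ∀ s, Tendsto (fun n : ℕ => (n : ℝ)⁻¹ * ∑ i ∈ Finset.Icc 1 n, (P ^ i) a s)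
      atTop (𝓝 (μ s))) (t : S) :
    ∑ s, μ s * P s t = μ t := by
  have h1 : Tendsto (fun n : ℕ =>
      ∑ s, ((n : ℝ)⁻¹ * ∑ i ∈ Finset.Icc 1 n, (P ^ i) a s) * P s t)
      atTop (𝓝 (∑ s, μ s * P s t)) :=
    tendsto_finsetSum _ fun s _ => (hμ s).mul_const _
  have h2 : ∀ n : ℕ, ∑ s, ((n : ℝ)⁻¹ * ∑ i ∈ Finset.Icc 1 n, (P ^ i) a s) * P s t =
      (n : ℝ)⁻¹ * ∑ i ∈ Finset.Icc 1 n, (P ^ i) a t + (n : ℝ)⁻¹ * ((P ^ (n + 1)) a t - P a t) := by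
    intro n
    have h3 : ∑ s, (∑ i ∈ Finset.Icc 1 n, (P ^ i) a s) * P s t =
        ∑ i ∈ Finset.Icc 1 n, (P ^ (i + 1)) a t := by
      simp only [Finset.sum_mul, pow_succ, Matrix.mul_apply]
      rw [Finset.sum_comm]
    have h4 : ∑ i ∈ Finset.Icc 1 n, (P ^ (i + 1)) a t =
        ∑ i ∈ Finset.Icc 1 n, (P ^ i) a t + ((P ^ (n + 1)) a t - P a t) := by
      rw [sum_Icc_one_eq_sum_range, sum_Icc_one_eq_sum_range]
      have h5 := Finset.sum_range_succ (fun i => (P ^ (i + 1)) a t) n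
      rw [Finset.sum_range_succ'] at h5
      simp only [zero_add, pow_one] at h5
      linarith
    simp only [mul_assoc]
    rw [← Finset.mul_sum, h3, h4, mul_add]
  have h3 : Tendsto (fun n : ℕ => (n : ℝ)⁻¹ * ((P ^ (n + 1)) a t - P a t)) atTop (𝓝 0) := by
    refine squeeze_zero_norm (fun n => ?_) (tendsto_inv_atTop_nhds_zero_nat (𝕜 := ℝ))
    rw [norm_mul, Real.norm_of_nonneg (by positivity : (0 : ℝ) ≤ (n : ℝ)⁻¹)]
    refine mul_le_of_le_one_right (by positivity) ?_
    rw [Real.norm_eq_abs, abs_le]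
    have := (hP.pow (n + 1)).1 a t
    have := (hP.pow (n + 1)).le_one a t
    have := hP.1 a t
    have := hP.le_one a t
    constructor <;> linarith
  have h4 := (hμ t).add h3
  rw [add_zero] at h4
  exact tendsto_nhds_unique (h1.congr h2) h4

theorem sum_eq_of_tendsto_cesaro {S : Type*} [Fintype S] [DecidableEq S]
    {P : Matrix S S ℝ} {a : S} {μ : S → ℝ} {R : Finset S} {r : ℝ}
    (hμ : ∀ s, Tendsto (fun n : ℕ => (n : ℝ)⁻¹ * ∑ i ∈ Finset.Icc 1 n, (P ^ i) a s)
      atTop (𝓝 (μ s)))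
    (hr : Tendsto (fun n : ℕ => ∑ t ∈ R, (P ^ n) a t) atTop (𝓝 r)) :
    ∑ s ∈ R, μ s = r := by
  have h1 : Tendsto (fun n : ℕ => ∑ s ∈ R, (n : ℝ)⁻¹ * ∑ i ∈ Finset.Icc 1 n, (P ^ i) a s)
      atTop (𝓝 (∑ s ∈ R, μ s)) := tendsto_finsetSum _ fun s _ => hμ s
  refine tendsto_nhds_unique (h1.congr fun n => ?_) (hr.comp (tendsto_add_atTop_nat 1)).cesaro
  rw [← Finset.mul_sum, Finset.sum_comm, sum_Icc_one_eq_sum_range]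
  rfl

theorem IsBSCC.mem_of_reflTransGen {S : Type*} [Fintype S] {P : Matrix S S ℝ} {R : Finset S}
    (hR : IsBSCC P R) {a b : S} (ha : a ∈ R)
    (hab : Relation.ReflTransGen (fun x y => 0 < P x y) a b) : b ∈ R := by
  induction hab with
  | refl => exact ha
  | tail _ h ih =>
    by_contra hc
    exact h.ne' (hR.2.2.2 _ ih _ hc)

theorem IsBSCC.disjoint {S : Type*} [Fintype S] {P : Matrix S S ℝ} {R R' : Finset S}
    (hR : IsBSCC P R) (hR' : IsBSCC P R') (hne : R ≠ R') : Disjoint R R' := by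
  rw [Finset.disjoint_left]
  intro x hx hx'
  exact hne (Finset.Subset.antisymm
    (fun b hb => hR'.mem_of_reflTransGen hx' (hR.2.1 x hx b hb))
    (fun b hb => hR.mem_of_reflTransGen hx (hR'.2.1 x hx' b hb)))

/-- A nonnegative invariant vector on a BSCC which is positive somewhere is positive everywhere. -/
theorem IsBSCC.pos_of_pos {S : Type*} [Fintype S] {P : Matrix S S ℝ} (hP : IsStochastic P)
    {R : Finset S} (hR : IsBSCC P R) {v : S → ℝ} (hv : ∀ s ∈ R, 0 ≤ v s)
    (hinv : ∀ t ∈ R, ∑ s ∈ R, v s * P s t = v t) {a b : S} (ha : a ∈ R) (hb : b ∈ R)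
    (hva : 0 < v a) : 0 < v b := by
  have hab := hR.2.1 a ha b hb
  clear hb
  induction hab with
  | refl => exact hva
  | @tail c d hac hcd ih =>
    have hc := hR.mem_of_reflTransGen ha hac
    rw [← hinv d (hR.mem_of_reflTransGen hc (.single hcd))]
    exact (mul_pos ih hcd).trans_le
      (Finset.single_le_sum (f := fun s => v s * P s d)
        (fun s hs => mul_nonneg (hv s hs) (hP.1 s d)) hc)

/-- Invariant vectors on a BSCC are proportional. -/
theorem IsBSCC.eq_sum_mul_of_invariant {S : Type*} [Fintype S] {P : Matrix S S ℝ}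
    (hP : IsStochastic P) {R : Finset S} (hR : IsBSCC P R) {p v : S → ℝ}
    (hp : ∀ s ∈ R, 0 ≤ p s) (hpsum : ∑ s ∈ R, p s = 1)
    (hpinv : ∀ t ∈ R, ∑ s ∈ R, p s * P s t = p t)
    (hvinv : ∀ t ∈ R, ∑ s ∈ R, v s * P s t = v t) {s : S} (hs : s ∈ R) :
    v s = (∑ t ∈ R, v t) * p s := by
  have hppos : ∀ b ∈ R, 0 < p b := by
    obtain ⟨a, ha, hpa⟩ : ∃ a ∈ R, 0 < p a :=
      Finset.exists_lt_of_sum_lt (f := fun _ => (0 : ℝ)) (by simp [hpsum])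
    exact fun b hb => hR.pos_of_pos hP hp hpinv ha hb hpa
  obtain ⟨m, hm, hmin⟩ := R.exists_min_image (fun s => v s / p s) hR.1
  set c := v m / p m with hc
  have hw : ∀ t ∈ R, 0 ≤ v t - c * p t := fun t ht => by
    have := (le_div_iff₀ (hppos t ht)).1 (hmin t ht)
    linarith
  have hwinv : ∀ t ∈ R, ∑ s ∈ R, (v s - c * p s) * P s t = v t - c * p t := fun t ht => by
    simp only [sub_mul, Finset.sum_sub_distrib, mul_assoc, ← Finset.mul_sum, hpinv t ht,
      hvinv t ht]
  have hwm : v m - c * p m = 0 := by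
    rw [hc, div_mul_cancel₀ _ (hppos m hm).ne', sub_self]
  have hveq : ∀ t ∈ R, v t = c * p t := fun t ht => by
    by_contra hne
    have hpos := (hw t ht).lt_of_ne fun h => hne (by linarith)
    exact (hR.pos_of_pos hP hw hwinv ht hm hpos).ne' hwm
  rw [Finset.sum_congr rfl hveq, ← Finset.mul_sum, hpsum, mul_one]
  exact hveq s hs

/-- A nonnegative invariant vector is invariant when restricted to a BSCC: no mass flows in. -/
theorem IsBSCC.sum_mul_eq_of_invariant {S : Type*} [Fintype S] [DecidableEq S] {P : Matrix S S ℝ}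
    (hP : IsStochastic P) {R : Finset S} (hR : IsBSCC P R) {μ : S → ℝ} (hμ : ∀ s, 0 ≤ μ s)
    (hinv : ∀ t, ∑ s, μ s * P s t = μ t) {t : S} (ht : t ∈ R) :
    ∑ s ∈ R, μ s * P s t = μ t := by
  have hrow : ∀ s ∈ R, ∑ t ∈ R, P s t = 1 := fun s hs => by
    rw [← hP.2 s]
    exact Finset.sum_subset (Finset.subset_univ R) fun x _ hx => hR.2.2.2 s hs x hx
  have hle : ∀ t ∈ R, ∑ s ∈ R, μ s * P s t ≤ μ t := fun t _ => by
    conv_rhs => rw [← hinv t]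
    exact Finset.sum_le_sum_of_subset_of_nonneg (Finset.subset_univ R)
      fun s _ _ => mul_nonneg (hμ s) (hP.1 s t)
  have hsum : ∑ t ∈ R, ∑ s ∈ R, μ s * P s t = ∑ t ∈ R, μ t := by
    rw [Finset.sum_comm]
    exact Finset.sum_congr rfl fun s hs => by rw [← Finset.mul_sum, hrow s hs, mul_one]
  exact (Finset.sum_eq_sum_iff_of_le hle).1 hsum t ht

/-- Correctness of the termination condition: given a set `B` of BSCCs with
lower reachability bounds `ld R ∈ [0,1]`, `ld R ≤ reach(sinit,R)`, and bounds
`lR R ≤ π_R ≤ uR R` in `[0,1]` on the stationary distribution of each `R ∈ B`,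
if `(1 - L) + ∑_{R∈B} ld R · max_{s∈R}(uR R s - lR R s) ≤ ε` with
`L = ∑_{R∈B} ld R`, then for every `R ∈ B` and `s ∈ R` the values
`l(s) = ld R · lR R s` and `u(s) = (ld R + 1 - L) · uR R s` satisfy
`l(s) ≤ π sinit s ≤ u(s)` and `u(s) - l(s) ≤ ε`. -/
theorem stmt11 {S : Type*} [Fintype S] [DecidableEq S] [Nonempty S]
    (P : Matrix S S ℝ) (hP : IsStochastic P) (sinit : S) (ε : ℝ) (hε : 0 < ε)
    (π : S → S → ℝ)
    (hπ : ∀ sinit' s : S,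
      Tendsto (fun n : ℕ => (n : ℝ)⁻¹ * ∑ i ∈ Finset.Icc 1 n, (P ^ i) sinit' s)
        atTop (𝓝 (π sinit' s)))
    (reach : S → Finset S → ℝ)
    (hreach : ∀ (s : S) (R : Finset S), IsBSCC P R →
      Tendsto (fun n : ℕ => ∑ t ∈ R, (P ^ n) s t) atTop (𝓝 (reach s R)))
    (B : Finset (Finset S)) (hB : ∀ R ∈ B, IsBSCC P R)
    (hBne : ∀ R ∈ B, R.Nonempty)
    (πR : Finset S → S → ℝ)
    (hπR : ∀ R ∈ B,
      (∀ s, 0 ≤ πR R s) ∧ (∀ s ∉ R, πR R s = 0) ∧ (∑ s ∈ R, πR R s = 1) ∧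
      (∀ t ∈ R, ∑ s ∈ R, πR R s * P s t = πR R t))
    (ld : Finset S → ℝ) (lR uR : Finset S → S → ℝ)
    (hld : ∀ R ∈ B, 0 ≤ ld R ∧ ld R ≤ 1 ∧ ld R ≤ reach sinit R)
    (hbounds : ∀ R ∈ B, ∀ s ∈ R,
      0 ≤ lR R s ∧ lR R s ≤ πR R s ∧ πR R s ≤ uR R s ∧ uR R s ≤ 1)
    (hterm : (1 - ∑ R ∈ B, ld R) +
        ∑ R ∈ B.attach,
          ld R.1 * (R.1.sup' (hBne R.1 R.2) fun s => uR R.1 s - lR R.1 s) ≤ ε) :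
    ∀ R ∈ B, ∀ s ∈ R,
      ld R * lR R s ≤ π sinit s ∧
      π sinit s ≤ (ld R + 1 - ∑ R' ∈ B, ld R') * uR R s ∧
      (ld R + 1 - ∑ R' ∈ B, ld R') * uR R s - ld R * lR R s ≤ ε := by
  have hμ0 : ∀ s, 0 ≤ π sinit s := fun s =>
    ge_of_tendsto' (hπ sinit s) fun n =>
      mul_nonneg (by positivity) (Finset.sum_nonneg fun i _ => (hP.pow i).1 sinit s)
  have hinv := hP.sum_mul_eq_of_tendsto_cesaro (hπ sinit)
  have hmass : ∀ R ∈ B, ∑ s ∈ R, π sinit s = reach sinit R := fun R hR =>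
    sum_eq_of_tendsto_cesaro (hπ sinit) (hreach sinit R (hB R hR))
  have hkey : ∀ R ∈ B, ∀ s ∈ R, π sinit s = reach sinit R * πR R s := fun R hR s hs => by
    obtain ⟨h0, _, h1, h2⟩ := hπR R hR
    rw [← hmass R hR]
    exact (hB R hR).eq_sum_mul_of_invariant hP (fun s _ => h0 s) h1 h2
      (fun t ht => (hB R hR).sum_mul_eq_of_invariant hP hμ0 hinv ht) hs
  have hreach1 : ∑ R ∈ B, reach sinit R ≤ 1 := by
    refine le_of_tendsto' (tendsto_finsetSum B fun R hR => hreach sinit R (hB R hR)) fun n => ?_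
    rw [← Finset.sum_biUnion fun R hR R' hR' hne => (hB R hR).disjoint (hB R' hR') hne,
      ← (hP.pow n).2 sinit]
    exact Finset.sum_le_sum_of_subset_of_nonneg (Finset.subset_univ _)
      fun t _ _ => (hP.pow n).1 sinit t
  intro R hR s hs
  obtain ⟨hl0, hlp, hpu, hu1⟩ := hbounds R hR s hs
  obtain ⟨hd0, hd1, hdr⟩ := hld R hR
  have hp0 : 0 ≤ πR R s := hl0.trans hlp
  have hL : ∑ R' ∈ B, ld R' ≤ 1 :=
    (Finset.sum_le_sum fun R' hR' => (hld R' hR').2.2).trans hreach1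
  have hreachle : reach sinit R ≤ ld R + 1 - ∑ R' ∈ B, ld R' := by
    have h := Finset.sum_le_sum (s := B.erase R) (f := ld) (g := reach sinit)
      fun R' hR' => (hld R' (Finset.mem_of_mem_erase hR')).2.2
    have := Finset.add_sum_erase B ld hR
    have := Finset.add_sum_erase B (reach sinit) hR
    linarith
  refine ⟨?_, ?_, ?_⟩
  · rw [hkey R hR s hs]
    exact mul_le_mul hdr hlp hl0 (hd0.trans hdr)
  · rw [hkey R hR s hs]
    exact mul_le_mul hreachle hpu hp0 ((hd0.trans hdr).trans hreachle)
  · have hsup : uR R s - lR R s ≤ R.sup' (hBne R hR) fun s => uR R s - lR R s :=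
      Finset.le_sup' (fun s => uR R s - lR R s) hs
    have hterm_le : ld R * (R.sup' (hBne R hR) fun s => uR R s - lR R s) ≤
        ∑ R ∈ B.attach, ld R.1 * (R.1.sup' (hBne R.1 R.2) fun s => uR R.1 s - lR R.1 s) := by
      refine Finset.single_le_sum
        (f := fun R : B => ld R.1 * (R.1.sup' (hBne R.1 R.2) fun s => uR R.1 s - lR R.1 s))
        (fun R' _ => mul_nonneg (hld R'.1 R'.2).1 ?_) (Finset.mem_attach B ⟨R, hR⟩)
      obtain ⟨x, hx⟩ := hBne R'.1 R'.2
      obtain ⟨_, h1, h2, _⟩ := hbounds R'.1 R'.2 x hx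
      exact (sub_nonneg.2 (h1.trans h2)).trans
        (Finset.le_sup' (fun s => uR R'.1 s - lR R'.1 s) hx)
    have h1 := mul_le_mul_of_nonneg_left hsup hd0
    have h2 := mul_le_mul_of_nonneg_left hu1 (sub_nonneg.2 hL)
    linarith
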